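/- Let f ∈ C²_p. Then there exist h₀ > 0 and a ≥ 0 (depending only on f and the penalty function φ) such that for all h ∈ (0,h₀], I^Mart(h)f = sup over ν ∈ M_p(μ) with W_p^Mart(μ,ν) ≤ √(ah) of ( ∫_X f dν − φ_h(W_p^Mart(μ,ν)²) ). -/

import Mathlib

open MeasureTheory Filter Set
open scoped Topology ENNReal NNReal RealInnerProductSpace

noncomputable section

variable {X : Type*} [NormedAddCommGroup X] [InnerProductSpace ℝ X]
  [SecondCountableTopology X] [CompleteSpace X] [MeasurableSpace X] [BorelSpace X]

/-- `π` is a coupling of `μ` and `ν`. -/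
def IsCoupling (μ ν : Measure X) (π : Measure (X × X)) : Prop :=
  π.map Prod.fst = μ ∧ π.map Prod.snd = ν

/-- The `p`-Wasserstein distance between `μ` and `ν` (valued in `ℝ≥0∞`). -/
def Wp (p : ℝ) (μ ν : Measure X) : ℝ≥0∞ :=
  (⨅ π ∈ {π : Measure (X × X) | IsCoupling μ ν π},
    ∫⁻ q, (‖q.1 - q.2‖₊ : ℝ≥0∞) ^ p ∂π) ^ (1 / p)

/-- Borel probability measures with finite `p`-th moment. -/
def Pp (p : ℝ) : Set (Measure X) :=
  {ν | IsProbabilityMeasure ν ∧ ∫⁻ x, (‖x‖₊ : ℝ≥0∞) ^ p ∂ν < ⊤}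

/-- The rescaled penalty function `φ_h(v) = h·φ(v/h)`. -/
def phih (φ : ℝ → ℝ≥0∞) (h v : ℝ) : ℝ≥0∞ := ENNReal.ofReal h * φ (v / h)

/-- The risk functional `I(h) f`. -/
def Ifun (μ : Measure X) (φ : ℝ → ℝ≥0∞) (p h : ℝ) (f : X → ℝ) : EReal :=
  ⨆ ν ∈ Pp (X := X) p,
    ((∫ x, f x ∂ν : ℝ) : EReal) - ((phih φ h (Wp p μ ν).toReal : ℝ≥0∞) : EReal)

/-- The `L_p(μ; X)` norm of a vector field. -/
def lpnorm (μ : Measure X) (p : ℝ) (θ : X → X) : ℝ := (∫ y, ‖θ y‖ ^ p ∂μ) ^ (1 / p)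

/-- The parametric risk functional `I_Θ(h) f`, where `μ_θ` is the pushforward of `μ`
under `y ↦ y + θ(y)`. -/
def ITheta (μ : Measure X) (φ : ℝ → ℝ≥0∞) (p : ℝ) (Θ : Set (X → X)) (h : ℝ)
    (f : X → ℝ) : EReal :=
  ⨆ θ ∈ Θ, ((∫ x, f x ∂(μ.map fun y => y + θ y) : ℝ) : EReal)
    - ((phih φ h (lpnorm μ p θ) : ℝ≥0∞) : EReal)

/-- Membership in `Lip_p`. -/
def MemLipP (p : ℝ) (f : X → ℝ) : Prop :=
  ∃ L : ℝ, 0 ≤ L ∧ ∀ x₁ x₂ : X,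
    |f x₁ - f x₂| ≤ L * (1 + max ‖x₁‖ ‖x₂‖) ^ (p - 1) * ‖x₁ - x₂‖

/-- The local Lipschitz constant `|f|_Lip`. -/
def locLip (f : X → ℝ) (x : X) : ℝ :=
  limsup (fun h : ℝ =>
      sSup ((fun u : X => (f (x + h • u) - f x) / h) '' {u : X | ‖u‖ = 0 ∨ ‖u‖ = 1}))
    (𝓝[>] (0 : ℝ))

/-- `v` is a measurable direction of steepest ascent for `f`. -/
def SteepestAscent (f : X → ℝ) (v : X → X) : Prop :=
  Measurable v ∧ ∀ x : X, (‖v x‖ = 0 ∨ ‖v x‖ = 1) ∧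
    Tendsto (fun h : ℝ => (f (x + h • v x) - f x) / h) (𝓝[>] (0 : ℝ)) (𝓝 (locLip f x))

/-- The convex conjugate `φ*` of the penalty function. -/
def phiStar (φ : ℝ → ℝ≥0∞) (u : ℝ) : EReal :=
  ⨆ v ∈ Ici (0 : ℝ), ((u * v : ℝ) : EReal) - ((φ v : ℝ≥0∞) : EReal)

/-- `π` is a martingale coupling of `μ` and `ν`. -/
def IsMartCoupling (μ ν : Measure X) (π : Measure (X × X)) : Prop :=
  IsCoupling μ ν π ∧ ∀ B : Set X, MeasurableSet B →
    ∫ q, Set.indicator B (fun _ => (1 : ℝ)) q.1 • q.2 ∂π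
      = ∫ y, Set.indicator B (fun _ => (1 : ℝ)) y • y ∂μ

/-- Measures in `P_p` admitting a martingale coupling with `μ`. -/
def Mp (p : ℝ) (μ : Measure X) : Set (Measure X) :=
  {ν | ν ∈ Pp (X := X) p ∧ ∃ π : Measure (X × X), IsMartCoupling μ ν π}

/-- The `p`-martingale Wasserstein distance. -/
def WpMart (p : ℝ) (μ ν : Measure X) : ℝ≥0∞ :=
  (⨅ π ∈ {π : Measure (X × X) | IsMartCoupling μ ν π},
    ∫⁻ q, (‖q.2 - q.1‖₊ : ℝ≥0∞) ^ p ∂π) ^ (1 / p)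

/-- The martingale-constrained risk functional `I^Mart(h) f`. -/
def IMart (μ : Measure X) (φ : ℝ → ℝ≥0∞) (p h : ℝ) (f : X → ℝ) : EReal :=
  ⨆ ν ∈ Mp p μ, ((∫ x, f x ∂ν : ℝ) : EReal)
    - ((phih φ h ((WpMart p μ ν).toReal ^ 2) : ℝ≥0∞) : EReal)

/-- The randomized perturbation `μ_θ^Mart`, satisfying
`∫ f dμ_θ^Mart = ∫ (f(y+θ(y)) + f(y-θ(y)))/2 μ(dy)`. -/
def muMart (μ : Measure X) (θ : X → X) : Measure X :=
  (2 : ℝ≥0∞)⁻¹ • μ.map (fun y => y + θ y) + (2 : ℝ≥0∞)⁻¹ • μ.map (fun y => y - θ y)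

/-- The parametric martingale risk functional `I^Mart_Θ(h) f`. -/
def IMartTheta (μ : Measure X) (φ : ℝ → ℝ≥0∞) (p : ℝ) (Θ : Set (X → X)) (h : ℝ)
    (f : X → ℝ) : EReal :=
  ⨆ θ ∈ Θ, ((∫ x, f x ∂(muMart μ θ) : ℝ) : EReal)
    - ((phih φ h (lpnorm μ p θ ^ 2) : ℝ≥0∞) : EReal)

/-- Membership in `C²_p`: twice continuously Fréchet differentiable with Hessian growing
at most like `C(1+‖x‖)^{p-2}`. -/
def MemC2p (p : ℝ) (f : X → ℝ) : Prop :=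
  ContDiff ℝ 2 f ∧ ∃ C : ℝ, 0 ≤ C ∧
    ∀ x : X, ‖fderiv ℝ (fun y => gradient f y) x‖ ≤ C * (1 + ‖x‖) ^ (p - 2)

/-- `|∇²f(x)|_Max = sup_{‖w‖ ≤ 1} ⟪w, ∇²f(x) w⟫`. -/
def hessMax (f : X → ℝ) (x : X) : ℝ :=
  sSup ((fun w : X => ⟪w, fderiv ℝ (fun y => gradient f y) x w⟫) '' {w : X | ‖w‖ ≤ 1})

/-- If the gradient of `f` has derivative at most `C * (1 + ‖x‖) ^ r`, it is Lipschitz on balls. -/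
lemma norm_gradient_sub_le {f : X → ℝ} {C r R : ℝ} (hr : 0 ≤ r) (hC : 0 ≤ C)
    (hf : ContDiff ℝ 2 f)
    (hb : ∀ x : X, ‖fderiv ℝ (fun y => gradient f y) x‖ ≤ C * (1 + ‖x‖) ^ r)
    {w y : X} (hw : ‖w‖ ≤ R) (hy : ‖y‖ ≤ R) :
    ‖gradient f w - gradient f y‖ ≤ C * (1 + R) ^ r * ‖w - y‖ := by
  have hdiff : Differentiable ℝ (fun y => gradient f y) :=
    (InnerProductSpace.toDual ℝ X).symm.toContinuousLinearEquiv.differentiable.comp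
      ((hf.fderiv_right (m := 1) (by norm_num)).differentiable (by norm_num))
  refine (convex_closedBall (0 : X) R).norm_image_sub_le_of_norm_fderiv_le (𝕜 := ℝ)
    (f := fun y => gradient f y) (fun x _ => hdiff x) (fun x hx => (hb x).trans ?_)
    (by simpa using hy) (by simpa using hw)
  have hx' : ‖x‖ ≤ R := by simpa using hx
  gcongr

/-- Second order Taylor estimate on balls. -/
lemma abs_sub_sub_inner_gradient_le {f : X → ℝ} {C r R : ℝ} (hr : 0 ≤ r) (hC : 0 ≤ C)
    (hf : ContDiff ℝ 2 f)
    (hb : ∀ x : X, ‖fderiv ℝ (fun y => gradient f y) x‖ ≤ C * (1 + ‖x‖) ^ r)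
    {z y : X} (hz : ‖z‖ ≤ R) (hy : ‖y‖ ≤ R) :
    |f z - f y - ⟪gradient f y, z - y⟫| ≤ C * (1 + R) ^ r * ‖z - y‖ ^ 2 := by
  have hR : 0 ≤ R := (norm_nonneg _).trans hz
  have key := (convex_segment y z).norm_image_sub_le_of_norm_fderiv_le' (𝕜 := ℝ) (f := f)
    (φ := fderiv ℝ f y) (C := C * (1 + R) ^ r * ‖z - y‖)
    (fun x _ => hf.differentiable (by norm_num) x) (fun w hw => ?_)
    (left_mem_segment ℝ y z) (right_mem_segment ℝ y z)
  · rw [← toDual_gradient, InnerProductSpace.toDual_apply_apply, Real.norm_eq_abs] at key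
    linarith
  · have hwR : ‖w‖ ≤ R := by
      have := (convex_closedBall (0 : X) R).segment_subset (by simpa using hy)
        (by simpa using hz) hw
      simpa using this
    have hwy : ‖w - y‖ ≤ ‖z - y‖ := norm_sub_le_of_mem_segment hw
    rw [← toDual_gradient, ← toDual_gradient, ← map_sub, LinearIsometryEquiv.norm_map]
    refine (norm_gradient_sub_le hr hC hf hb hwR hy).trans ?_
    gcongr

/-- A Young type inequality with parameter `s`. -/
lemma add_rpow_mul_sq_le {p u d s : ℝ} (hp : 2 ≤ p) (hu : 0 ≤ u) (hd : 0 ≤ d) (hs : 0 < s) :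
    (u + d) ^ (p - 2) * d ^ 2
      ≤ 2 ^ (p - 2) * (s ^ 2 * u ^ p + s ^ (2 - p) * d ^ p + d ^ p) := by
  have hr : 0 ≤ p - 2 := by linarith
  have split : ∀ t : ℝ, 0 ≤ t → t ^ p = t ^ (p - 2) * t ^ 2 := fun t ht => by
    rw [← Real.rpow_natCast t 2, ← Real.rpow_add_of_nonneg ht hr (by norm_num)]
    congr 1
    push_cast
    ring
  have hsum : (u + d) ^ (p - 2) ≤ 2 ^ (p - 2) * (u ^ (p - 2) + d ^ (p - 2)) := by
    have hmax : (u + d) ^ (p - 2) ≤ (2 * max u d) ^ (p - 2) := by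
      gcongr
      linarith [le_max_left u d, le_max_right u d]
    rw [Real.mul_rpow (by norm_num) (le_max_of_le_left hu)] at hmax
    refine hmax.trans ?_
    gcongr
    have h1 := Real.rpow_nonneg hu (p - 2)
    have h2 := Real.rpow_nonneg hd (p - 2)
    rcases max_choice u d with h | h <;> rw [h] <;> linarith
  have hyoung : u ^ (p - 2) * d ^ 2 ≤ s ^ 2 * u ^ p + s ^ (2 - p) * d ^ p := by
    have h1 : 0 ≤ s ^ 2 * u ^ p := by positivity
    have h2 : 0 ≤ s ^ (2 - p) * d ^ p := by positivity
    rcases le_total d (s * u) with h | h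
    · have : u ^ (p - 2) * d ^ 2 ≤ u ^ (p - 2) * (s * u) ^ 2 := by gcongr
      rw [split u hu] at *
      linarith
    · have h3 : u ≤ s⁻¹ * d := by
        rw [inv_mul_eq_div, le_div_iff₀ hs]
        linarith
      have : u ^ (p - 2) * d ^ 2 ≤ (s⁻¹ * d) ^ (p - 2) * d ^ 2 := by gcongr
      rw [Real.mul_rpow (by positivity) hd, Real.inv_rpow hs.le, ← Real.rpow_neg hs.le,
        neg_sub] at this
      rw [split d hd] at *
      linarith
  calc (u + d) ^ (p - 2) * d ^ 2
      ≤ 2 ^ (p - 2) * (u ^ (p - 2) + d ^ (p - 2)) * d ^ 2 := by gcongr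
    _ = 2 ^ (p - 2) * (u ^ (p - 2) * d ^ 2 + d ^ p) := by rw [split d hd]; ring
    _ ≤ _ := by gcongr

lemma memLp_id_of_mem_Pp {p : ℝ} (hp : 0 < p) {ν : Measure X} (hν : ν ∈ Pp (X := X) p) :
    MemLp (fun x : X => x) (ENNReal.ofReal p) ν := by
  refine ⟨measurable_id.aestronglyMeasurable, ?_⟩
  rw [eLpNorm_lt_top_iff_lintegral_rpow_enorm_lt_top (by simpa using hp) (by simp),
    ENNReal.toReal_ofReal hp.le]
  exact hν.2

lemma IsCoupling.isProbabilityMeasure {μ ν : Measure X} [IsProbabilityMeasure μ]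
    {π : Measure (X × X)} (hπ : IsCoupling μ ν π) : IsProbabilityMeasure π := by
  have : IsProbabilityMeasure (π.map Prod.fst) := hπ.1 ▸ inferInstance
  exact Measure.isProbabilityMeasure_of_map Prod.fst

lemma IsCoupling.memLp_fst {p : ℝ} (hp : 0 < p) {μ ν : Measure X} (hμ : μ ∈ Pp (X := X) p)
    {π : Measure (X × X)} (hπ : IsCoupling μ ν π) :
    MemLp (fun q : X × X => q.1) (ENNReal.ofReal p) π :=
  (memLp_id_of_mem_Pp hp hμ).comp_measurePreserving ⟨measurable_fst, hπ.1⟩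

lemma IsCoupling.memLp_snd {p : ℝ} (hp : 0 < p) {μ ν : Measure X} (hν : ν ∈ Pp (X := X) p)
    {π : Measure (X × X)} (hπ : IsCoupling μ ν π) :
    MemLp (fun q : X × X => q.2) (ENNReal.ofReal p) π :=
  (memLp_id_of_mem_Pp hp hν).comp_measurePreserving ⟨measurable_snd, hπ.2⟩

lemma MeasureTheory.MemLp.integrable_norm_rpow_ofReal {α E : Type*} [MeasurableSpace α]
    [NormedAddCommGroup E] {p : ℝ} (hp : 0 < p) {π : Measure α} {g : α → E}
    (hg : MemLp g (ENNReal.ofReal p) π) : Integrable (fun x => ‖g x‖ ^ p) π := by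
  have := hg.integrable_norm_rpow (by simpa using hp) (by simp)
  rwa [ENNReal.toReal_ofReal hp.le] at this

lemma integrable_one_add_norm_rpow {p : ℝ} (hp : 0 < p) {ν : Measure X}
    (hν : ν ∈ Pp (X := X) p) : Integrable (fun y : X => (1 + ‖y‖) ^ p) ν := by
  have := hν.1
  refine (((memLp_const (1 : ℝ)).add (memLp_id_of_mem_Pp hp hν).norm).integrable_norm_rpow_ofReal
    hp).congr (ae_of_all _ fun y => ?_)
  simp only [Pi.add_apply, Real.norm_eq_abs]
  rw [abs_of_nonneg (by positivity)]

/-- Test functions of the first marginal are orthogonal to martingale increments. -/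
lemma IsMartCoupling.integral_inner_eq_zero {μ ν : Measure X} [IsProbabilityMeasure μ]
    {π : Measure (X × X)} (hπ : IsMartCoupling μ ν π)
    (h1 : Integrable (fun q : X × X => q.1) π) (h2 : Integrable (fun q : X × X => q.2) π)
    {g : X → X} (hg : Continuous g)
    (hint : Integrable (fun q : X × X => ⟪g q.1, q.2 - q.1⟫) π) :
    ∫ q, ⟪g q.1, q.2 - q.1⟫ ∂π = 0 := by
  have : IsProbabilityMeasure π := hπ.1.isProbabilityMeasure
  have hm : MeasurableSpace.comap (Prod.fst : X × X → X) ‹MeasurableSpace X› ≤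
      Prod.instMeasurableSpace := measurable_fst.comap_le
  have hcond : (0 : X × X → X) =ᵐ[π] π[fun q : X × X => q.2 - q.1 |
      MeasurableSpace.comap Prod.fst ‹MeasurableSpace X›] := by
    refine ae_eq_condExp_of_forall_setIntegral_eq hm (h2.sub h1)
      (fun s _ _ => integrableOn_zero) ?_ aestronglyMeasurable_zero
    rintro _ ⟨B, hB, rfl⟩ -
    have hB' : MeasurableSet (Prod.fst ⁻¹' B : Set (X × X)) := measurable_fst hB
    have hmart := hπ.2 B hB
    rw [← hπ.1.1] at hmart
    have hmeas : Measurable fun y : X => indicator B (fun _ => (1 : ℝ)) y • y :=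
      (measurable_const.indicator hB).smul measurable_id
    rw [integral_map measurable_fst.aemeasurable hmeas.aestronglyMeasurable] at hmart
    have hind : ∀ k : X × X → X, ∫ q, indicator B (fun _ => (1 : ℝ)) q.1 • k q ∂π
        = ∫ q in Prod.fst ⁻¹' B, k q ∂π := fun k => by
      rw [← integral_indicator hB']
      refine integral_congr_ae (ae_of_all _ fun q => ?_)
      by_cases hq : q.1 ∈ B <;> simp [indicator, hq]
    rw [hind, hind] at hmart
    rw [integral_sub h2.integrableOn h1.integrableOn, hmart]
    simp
  have hpull := condExp_bilin_of_aestronglyMeasurable_left (innerSL ℝ (E := X))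
    (m := MeasurableSpace.comap Prod.fst ‹MeasurableSpace X›) (μ := π)
    (f := fun q : X × X => g q.1) (g := fun q : X × X => q.2 - q.1)
    ((hg.measurable.comp (comap_measurable Prod.fst)).stronglyMeasurable.aestronglyMeasurable)
    hint (h2.sub h1)
  calc ∫ q, ⟪g q.1, q.2 - q.1⟫ ∂π
      = ∫ q, (π[fun q : X × X => innerSL ℝ (g q.1) (q.2 - q.1) |
          MeasurableSpace.comap Prod.fst ‹MeasurableSpace X›]) q ∂π :=
        (integral_condExp hm).symm
    _ = ∫ _, (0 : ℝ) ∂π := by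
        refine integral_congr_ae ?_
        filter_upwards [hpull, hcond] with q hq hq'
        rw [hq, ← hq']
        simp
    _ = 0 := by simp

/-- Expansion of `∫ f ∂ν - ∫ f ∂μ` along a martingale coupling. -/
lemma IsMartCoupling.integral_le {p : ℝ} (hp : 2 ≤ p) {μ ν : Measure X}
    (hμ : μ ∈ Pp (X := X) p) (hν : ν ∈ Pp (X := X) p) {π : Measure (X × X)}
    (hπ : IsMartCoupling μ ν π) {f : X → ℝ} {C : ℝ} (hC : 0 ≤ C) (hf : ContDiff ℝ 2 f)
    (hb : ∀ x : X, ‖fderiv ℝ (fun y => gradient f y) x‖ ≤ C * (1 + ‖x‖) ^ (p - 2))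
    {s : ℝ} (hs : 0 < s) :
    ∫ x, f x ∂ν ≤ ∫ x, f x ∂μ + C * 2 ^ (p - 2) *
      (s ^ 2 * ∫ y, (1 + ‖y‖) ^ p ∂μ + s ^ (2 - p) * ∫ q, ‖q.2 - q.1‖ ^ p ∂π
        + ∫ q, ‖q.2 - q.1‖ ^ p ∂π) := by
  have := hμ.1
  have := hν.1
  have : IsProbabilityMeasure π := hπ.1.isProbabilityMeasure
  have hp0 : 0 < p := by linarith
  have hr : 0 ≤ p - 2 := by linarith
  have hp1 : (1 : ℝ≥0∞) ≤ ENNReal.ofReal p := by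
    rw [ENNReal.one_le_ofReal]; linarith
  have hfst := hπ.1.memLp_fst hp0 hμ
  have hsnd := hπ.1.memLp_snd hp0 hν
  have hcont : Continuous (gradient f) :=
    (InnerProductSpace.toDual ℝ X).symm.continuous.comp (hf.continuous_fderiv (by norm_num))
  have hbound : Integrable (fun q : X × X => (1 + ‖q.1‖ + ‖q.2‖) ^ p) π := by
    refine ((((memLp_const (1 : ℝ)).add hfst.norm).add hsnd.norm).integrable_norm_rpow_ofReal
      hp0).congr (ae_of_all _ fun q => ?_)
    simp only [Pi.add_apply, Real.norm_eq_abs]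
    rw [abs_of_nonneg (by positivity)]
  have hd : Integrable (fun q : X × X => ‖q.2 - q.1‖ ^ p) π :=
    (hsnd.sub hfst).integrable_norm_rpow_ofReal hp0
  have hM := integrable_one_add_norm_rpow hp0 hμ
  have hMπ : Integrable (fun q : X × X => (1 + ‖q.1‖) ^ p) π :=
    (MeasurePreserving.mk measurable_fst hπ.1.1).integrable_comp_of_integrable hM
  have hMeq : ∫ q, (1 + ‖q.1‖) ^ p ∂π = ∫ y, (1 + ‖y‖) ^ p ∂μ := by
    rw [← hπ.1.1, integral_map measurable_fst.aemeasurable]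
    rw [hπ.1.1]
    exact hM.aestronglyMeasurable
  set G := ‖gradient f 0‖ + C with hG
  have hG0 : 0 ≤ G := by positivity
  have rpow_split : ∀ t : ℝ, 0 < t → ∀ k : ℕ, t ^ (p - k) * t ^ k = t ^ p := fun t ht k => by
    rw [← Real.rpow_natCast t k, ← Real.rpow_add ht, sub_add_cancel]
  have hgrad : ∀ y : X, ‖gradient f y‖ ≤ G * (1 + ‖y‖) ^ (p - 1) := fun y => by
    have h := norm_gradient_sub_le hr hC hf hb (le_refl ‖y‖) (y := 0) (by simp)
    rw [sub_zero] at h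
    have h1 : (1 : ℝ) ≤ (1 + ‖y‖) ^ (p - 1) :=
      Real.one_le_rpow (by linarith [norm_nonneg y]) (by linarith)
    have h2 : (1 + ‖y‖) ^ (p - 2) * ‖y‖ ≤ (1 + ‖y‖) ^ (p - 1) := by
      have : (1 + ‖y‖) ^ (p - 1) = (1 + ‖y‖) ^ (p - 2) * (1 + ‖y‖) := by
        rw [← Real.rpow_add_one (by positivity)]
        congr 1
        ring
      rw [this]
      gcongr
      linarith
    have h3 := norm_le_norm_add_norm_sub' (gradient f y) (gradient f 0)
    calc ‖gradient f y‖ ≤ ‖gradient f 0‖ * 1 + C * ((1 + ‖y‖) ^ (p - 2) * ‖y‖) := by linarith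
      _ ≤ ‖gradient f 0‖ * (1 + ‖y‖) ^ (p - 1) + C * (1 + ‖y‖) ^ (p - 1) := by gcongr
      _ = _ := by rw [hG]; ring
  have hinner : ∀ y v : X, ∀ t : ℝ, 1 + ‖y‖ ≤ t → ‖v‖ ≤ t → |⟪gradient f y, v⟫| ≤ G * t ^ p := by
    intro y v t hy hv
    have ht : 0 < t := by linarith [norm_nonneg y]
    have hp1' : 0 ≤ p - 1 := by linarith
    calc |⟪gradient f y, v⟫| ≤ ‖gradient f y‖ * ‖v‖ := abs_real_inner_le_norm _ _
      _ ≤ G * (1 + ‖y‖) ^ (p - 1) * ‖v‖ := by gcongr; exact hgrad y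
      _ ≤ G * t ^ (p - 1) * t := by gcongr
      _ = G * t ^ p := by
        have := rpow_split t ht 1
        rw [pow_one, Nat.cast_one] at this
        rw [mul_assoc, this]
  have hint_inner : Integrable (fun q : X × X => ⟪gradient f q.1, q.2 - q.1⟫) π := by
    refine (hbound.const_mul G).mono' ?_ (ae_of_all _ fun q => ?_)
    · exact Continuous.aestronglyMeasurable (by fun_prop)
    · refine hinner _ _ _ ?_ ?_
      · linarith [norm_nonneg q.2]
      · linarith [norm_sub_le q.2 q.1]
  have hfint : ∀ ρ : Measure X, ρ ∈ Pp (X := X) p → Integrable f ρ := fun ρ hρ => by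
    have := hρ.1
    have hI := integrable_one_add_norm_rpow hp0 hρ
    refine ((integrable_const |f 0|).add (hI.const_mul (G + C))).mono'
      hf.continuous.aestronglyMeasurable (ae_of_all _ fun z => ?_)
    have h1 := abs_sub_sub_inner_gradient_le hr hC hf hb (le_refl ‖z‖) (y := 0) (by simp)
    rw [sub_zero] at h1
    have h2 := hinner 0 z (1 + ‖z‖) (by simp) (by simp)
    have h3 : (1 + ‖z‖) ^ (p - 2) * ‖z‖ ^ 2 ≤ (1 + ‖z‖) ^ p := by
      have := rpow_split (1 + ‖z‖) (by positivity) 2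
      push_cast at this
      rw [← this]
      gcongr
      linarith
    have h4 := mul_le_mul_of_nonneg_left h3 hC
    simp only [Pi.add_apply, Real.norm_eq_abs]
    rw [abs_le] at h1 h2 ⊢
    constructor
    · linarith [h1.1, h2.1, neg_abs_le (f 0)]
    · linarith [h1.2, h2.2, le_abs_self (f 0)]
  have hfν : Integrable (fun q : X × X => f q.2) π :=
    (MeasurePreserving.mk measurable_snd hπ.1.2).integrable_comp_of_integrable (hfint ν hν)
  have hfμ : Integrable (fun q : X × X => f q.1) π :=
    (MeasurePreserving.mk measurable_fst hπ.1.1).integrable_comp_of_integrable (hfint μ hμ)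
  have eν : ∫ x, f x ∂ν = ∫ q, f q.2 ∂π := by
    rw [← hπ.1.2, integral_map measurable_snd.aemeasurable hf.continuous.aestronglyMeasurable]
  have eμ : ∫ x, f x ∂μ = ∫ q, f q.1 ∂π := by
    rw [← hπ.1.1, integral_map measurable_fst.aemeasurable hf.continuous.aestronglyMeasurable]
  have hzero := hπ.integral_inner_eq_zero (hfst.integrable hp1) (hsnd.integrable hp1) hcont
    hint_inner
  have hpt : ∀ q : X × X, f q.2 ≤ f q.1 + ⟪gradient f q.1, q.2 - q.1⟫ + C * 2 ^ (p - 2) *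
      (s ^ 2 * (1 + ‖q.1‖) ^ p + s ^ (2 - p) * ‖q.2 - q.1‖ ^ p + ‖q.2 - q.1‖ ^ p) := fun q => by
    have h1 := abs_sub_sub_inner_gradient_le hr hC hf hb (z := q.2) (y := q.1)
      (R := ‖q.1‖ + ‖q.2 - q.1‖) (norm_le_norm_add_norm_sub' q.2 q.1) (by simp)
    have h2 := mul_le_mul_of_nonneg_left
      (add_rpow_mul_sq_le hp (u := 1 + ‖q.1‖) (d := ‖q.2 - q.1‖) (by positivity)
        (norm_nonneg _) hs) hC
    rw [← add_assoc] at h1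
    linarith [(abs_le.1 h1).2]
  have hI12 := hfμ.add hint_inner
  have hI3 : Integrable (fun q : X × X => s ^ 2 * (1 + ‖q.1‖) ^ p + s ^ (2 - p) * ‖q.2 - q.1‖ ^ p)
      π := (hMπ.const_mul _).add (hd.const_mul _)
  have hI4 : Integrable (fun q : X × X => C * 2 ^ (p - 2) *
      (s ^ 2 * (1 + ‖q.1‖) ^ p + s ^ (2 - p) * ‖q.2 - q.1‖ ^ p + ‖q.2 - q.1‖ ^ p)) π :=
    (hI3.add hd).const_mul _
  have hmono := integral_mono hfν (hI12.add hI4) hpt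
  rw [integral_add' hI12 hI4, integral_add' hfμ hint_inner, hzero, integral_const_mul,
    integral_add hI3 hd, integral_add (hMπ.const_mul _) (hd.const_mul _),
    integral_const_mul, integral_const_mul, hMeq, ← eν, ← eμ, add_zero] at hmono
  exact hmono

lemma lintegral_eq_ofReal_integral_norm_sub_rpow {p : ℝ} (hp : 0 < p) {μ ν : Measure X}
    (hμ : μ ∈ Pp (X := X) p) (hν : ν ∈ Pp (X := X) p) {π : Measure (X × X)}
    (hπ : IsCoupling μ ν π) :
    ∫⁻ q, (‖q.2 - q.1‖₊ : ℝ≥0∞) ^ p ∂π = ENNReal.ofReal (∫ q, ‖q.2 - q.1‖ ^ p ∂π) := by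
  have hint : Integrable (fun q : X × X => ‖q.2 - q.1‖ ^ p) π :=
    ((hπ.memLp_snd hp hν).sub (hπ.memLp_fst hp hμ)).integrable_norm_rpow_ofReal hp
  rw [ofReal_integral_eq_lintegral_ofReal hint (ae_of_all _ fun q => by positivity)]
  refine lintegral_congr fun q => ?_
  rw [← ENNReal.ofReal_rpow_of_nonneg (norm_nonneg _) hp.le, ofReal_norm, enorm_eq_nnnorm]

lemma WpMart_ne_top {p : ℝ} (hp : 0 < p) {μ ν : Measure X} (hμ : μ ∈ Pp (X := X) p)
    (hν : ν ∈ Mp p μ) : WpMart p μ ν ≠ ⊤ := by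
  obtain ⟨hν, π, hπ⟩ := hν
  refine (ENNReal.rpow_lt_top_of_nonneg (by positivity) (ne_top_of_le_ne_top ?_
    (iInf₂_le π hπ))).ne
  rw [lintegral_eq_ofReal_integral_norm_sub_rpow hp hμ hν hπ.1]
  exact ENNReal.ofReal_ne_top

lemma exists_isMartCoupling_integral_le {p : ℝ} (hp : 0 < p) {μ ν : Measure X}
    (hμ : μ ∈ Pp (X := X) p) (hν : ν ∈ Mp p μ) (hW : 0 < (WpMart p μ ν).toReal) :
    ∃ π, IsMartCoupling μ ν π ∧
      ∫ q, ‖q.2 - q.1‖ ^ p ∂π ≤ 2 * (WpMart p μ ν).toReal ^ p := by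
  set W := (WpMart p μ ν).toReal
  have hWp : 0 < W ^ p := by positivity
  have hinf : (⨅ π ∈ {π : Measure (X × X) | IsMartCoupling μ ν π},
      ∫⁻ q, (‖q.2 - q.1‖₊ : ℝ≥0∞) ^ p ∂π) < ENNReal.ofReal (2 * W ^ p) := by
    have h1 : (⨅ π ∈ {π : Measure (X × X) | IsMartCoupling μ ν π},
      ∫⁻ q, (‖q.2 - q.1‖₊ : ℝ≥0∞) ^ p ∂π) = WpMart p μ ν ^ p := by
      rw [WpMart, ← ENNReal.rpow_mul, one_div_mul_cancel hp.ne', ENNReal.rpow_one]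
    rw [h1, ← ENNReal.ofReal_toReal (WpMart_ne_top hp hμ hν),
      ENNReal.ofReal_rpow_of_nonneg hW.le hp.le]
    exact (ENNReal.ofReal_lt_ofReal_iff (by positivity)).2 (by linarith)
  simp only [iInf_lt_iff] at hinf
  obtain ⟨π, hπ, hlt⟩ := hinf
  refine ⟨π, hπ, ?_⟩
  rw [lintegral_eq_ofReal_integral_norm_sub_rpow hp hμ hν.1 hπ.1] at hlt
  exact ((ENNReal.ofReal_lt_ofReal_iff (by positivity)).1 hlt).le

lemma isMartCoupling_diag (μ : Measure X) : IsMartCoupling μ μ (μ.map fun x => (x, x)) := by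
  have hd : Measurable fun x : X => (x, x) := by fun_prop
  refine ⟨⟨?_, ?_⟩, fun B hB => ?_⟩
  · rw [Measure.map_map measurable_fst hd]
    exact Measure.map_id
  · rw [Measure.map_map measurable_snd hd]
    exact Measure.map_id
  · exact integral_map hd.aemeasurable (Measurable.aestronglyMeasurable
      (((measurable_const.indicator hB).comp measurable_fst).smul measurable_snd))

lemma self_mem_Mp {p : ℝ} {μ : Measure X} (hμ : μ ∈ Pp (X := X) p) : μ ∈ Mp p μ :=
  ⟨hμ, _, isMartCoupling_diag μ⟩

lemma WpMart_self {p : ℝ} (hp : 0 < p) (μ : Measure X) : WpMart p μ μ = 0 := by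
  rw [WpMart, ENNReal.rpow_eq_zero_iff_of_pos (by positivity), ← nonpos_iff_eq_zero]
  refine (iInf₂_le _ (isMartCoupling_diag μ)).trans ?_
  rw [lintegral_map (by fun_prop) (by fun_prop)]
  simp [hp]

/-- A positive lower limit of `φ v / v ^ r` gives a lower bound `c * v ^ r` for large `v`. -/
lemma exists_ofReal_mul_rpow_le {r : ℝ} {φ : ℝ → ℝ≥0∞}
    (hgrowth : 0 < liminf (fun v : ℝ => φ v / ENNReal.ofReal (v ^ r)) atTop) :
    ∃ c : ℝ, 0 < c ∧ ∀ᶠ v in atTop, ENNReal.ofReal (c * v ^ r) ≤ φ v := by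
  obtain ⟨c, hc0, hc⟩ := ENNReal.lt_iff_exists_nnreal_btwn.1 hgrowth
  refine ⟨c, by exact_mod_cast hc0, ?_⟩
  filter_upwards [eventually_lt_of_lt_liminf hc, eventually_gt_atTop 0] with v hv hv0
  rw [ENNReal.ofReal_mul c.coe_nonneg, ENNReal.ofReal_coe_nnreal]
  exact ENNReal.mul_le_of_le_div hv.le

/-- The penalty dominates the second order remainder outside a ball of squared radius `a * h`. -/
lemma exists_forall_remainder_le {p c K M : ℝ} (hp : 2 < p) (hc : 0 < c) (hK : 0 ≤ K) (v₀ : ℝ) :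
    ∃ h₀ : ℝ, 0 < h₀ ∧ ∃ a : ℝ, 0 ≤ a ∧ v₀ ≤ a ∧ ∀ h W : ℝ, 0 < h → h ≤ h₀ → 0 < W →
      a * h < W ^ 2 →
      K * (W ^ 2 * M + W ^ (2 - p) * (2 * W ^ p) + 2 * W ^ p)
        ≤ h * (c * (W ^ 2 / h) ^ (p / 2)) := by
  have hr : 0 < p / 2 - 1 := by linarith
  have hh : ∀ᶠ h : ℝ in 𝓝[>] 0, 2 * K * h ^ (p / 2 - 1) < c / 2 := by
    have : Tendsto (fun h : ℝ => 2 * K * h ^ (p / 2 - 1)) (𝓝 0) (𝓝 (2 * K * 0 ^ (p / 2 - 1))) :=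
      ((Real.continuousAt_rpow_const 0 _ (Or.inr hr.le)).tendsto).const_mul _
    rw [Real.zero_rpow hr.ne', mul_zero] at this
    exact (this.mono_left nhdsWithin_le_nhds).eventually_lt_const (by positivity)
  obtain ⟨h₀, hh₀, hpos⟩ := (hh.and self_mem_nhdsWithin).exists
  have ha : ∀ᶠ a : ℝ in atTop, K * (M + 2) ≤ c / 2 * a ^ (p / 2 - 1) :=
    ((tendsto_rpow_atTop hr).const_mul_atTop (by positivity)).eventually_ge_atTop _
  obtain ⟨a, haK, ha0, hav⟩ := (ha.and ((eventually_ge_atTop 0).and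
    (eventually_ge_atTop v₀))).exists
  refine ⟨h₀, hpos, a, ha0, hav, fun h W h0 hle W0 hW => ?_⟩
  obtain ⟨t, ht⟩ : ∃ t, t = W ^ 2 / h := ⟨_, rfl⟩
  have hWt : W ^ 2 = h * t := by rw [ht]; field_simp
  have ht0 : 0 < t := by rw [ht]; positivity
  have hat : a < t := by rw [ht, lt_div_iff₀ h0]; exact hW
  have hWp : W ^ p = (h * t) ^ (p / 2) := by
    rw [← hWt, ← Real.rpow_natCast W 2, ← Real.rpow_mul W0.le]
    congr 1
    push_cast
    ring
  have hW2 : W ^ (2 - p) * W ^ p = h * t := by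
    rw [← hWt, ← Real.rpow_add W0, ← Real.rpow_natCast W 2]
    congr 1
    push_cast
    ring
  have split : ∀ x : ℝ, 0 < x → x ^ (p / 2) = x ^ (p / 2 - 1) * x := fun x hx => by
    rw [← Real.rpow_add_one hx.ne', sub_add_cancel]
  have h1 : K * (M + 2) ≤ c / 2 * t ^ (p / 2 - 1) := haK.trans (by gcongr)
  have h2 : 2 * K * h ^ (p / 2 - 1) ≤ c / 2 :=
    le_trans (by gcongr) hh₀.le
  have h3 := mul_le_mul_of_nonneg_right h1 (mul_pos h0 ht0).le
  have h4 := mul_le_mul_of_nonneg_right h2 (show 0 ≤ h * t ^ (p / 2) by positivity)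
  rw [← ht]
  calc K * (W ^ 2 * M + W ^ (2 - p) * (2 * W ^ p) + 2 * W ^ p)
      = K * (W ^ 2 * M + 2 * (W ^ (2 - p) * W ^ p) + 2 * W ^ p) := by ring
    _ = K * (M + 2) * (h * t) + 2 * K * h ^ (p / 2 - 1) * (h * t ^ (p / 2)) := by
      rw [hW2, hWp, hWt, Real.mul_rpow h0.le ht0.le, split h h0]
      ring
    _ ≤ c / 2 * t ^ (p / 2 - 1) * (h * t) + c / 2 * (h * t ^ (p / 2)) := add_le_add h3 h4
    _ = h * (c * t ^ (p / 2)) := by rw [split t ht0]; ring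

theorem stmt13 (p : ℝ) (hp : 2 < p)
    (μ : Measure X) (hμ : μ ∈ Pp (X := X) p)
    (φ : ℝ → ℝ≥0∞) (hmono : MonotoneOn φ (Ici (0 : ℝ))) (hzero : φ 0 = 0)
    (hgrowth : 0 < liminf (fun v : ℝ => φ v / ENNReal.ofReal (v ^ (p / 2))) atTop)
    (f : X → ℝ) (hf : MemC2p p f) :
    ∃ h₀ : ℝ, 0 < h₀ ∧ ∃ a : ℝ, 0 ≤ a ∧ ∀ h : ℝ, 0 < h → h ≤ h₀ →
      IMart μ φ p h f =
        ⨆ ν ∈ {ν | ν ∈ Mp p μ ∧ WpMart p μ ν ≤ ENNReal.ofReal (Real.sqrt (a * h))},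
          ((∫ x, f x ∂ν : ℝ) : EReal)
            - ((phih φ h ((WpMart p μ ν).toReal ^ 2) : ℝ≥0∞) : EReal) := by
  obtain ⟨hf2, C, hC, hb⟩ := hf
  have hp0 : 0 < p := by linarith
  obtain ⟨c, hc, hev⟩ := exists_ofReal_mul_rpow_le hgrowth
  obtain ⟨v₀, hv₀⟩ := eventually_atTop.1 hev
  obtain ⟨h₀, hh₀, a, ha, hav, hrem⟩ := exists_forall_remainder_le
    (K := C * 2 ^ (p - 2)) (M := ∫ y, (1 + ‖y‖) ^ p ∂μ) hp hc (by positivity) v₀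
  refine ⟨h₀, hh₀, a, ha, fun h h0 hle => le_antisymm (iSup₂_le fun ν hν => ?_)
    (biSup_mono fun ν hν => hν.1)⟩
  by_cases hWle : WpMart p μ ν ≤ ENNReal.ofReal (Real.sqrt (a * h))
  · exact le_iSup₂ (f := fun ν (_ : ν ∈ {ν | ν ∈ Mp p μ ∧
      WpMart p μ ν ≤ ENNReal.ofReal (Real.sqrt (a * h))}) => ((∫ x, f x ∂ν : ℝ) : EReal)
        - ((phih φ h ((WpMart p μ ν).toReal ^ 2) : ℝ≥0∞) : EReal)) ν ⟨hν, hWle⟩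
  have hμself : ((∫ x, f x ∂μ : ℝ) : EReal) = ((∫ x, f x ∂μ : ℝ) : EReal)
      - ((phih φ h ((WpMart p μ μ).toReal ^ 2) : ℝ≥0∞) : EReal) := by
    simp [WpMart_self hp0, phih, hzero]
  refine le_trans ?_ (hμself.le.trans (le_iSup₂ (f := fun ν (_ : ν ∈ {ν | ν ∈ Mp p μ ∧
      WpMart p μ ν ≤ ENNReal.ofReal (Real.sqrt (a * h))}) => ((∫ x, f x ∂ν : ℝ) : EReal)
        - ((phih φ h ((WpMart p μ ν).toReal ^ 2) : ℝ≥0∞) : EReal)) μ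
        ⟨self_mem_Mp hμ, by simp [WpMart_self hp0]⟩))
  set W := (WpMart p μ ν).toReal with hWdef
  have hsqrt : Real.sqrt (a * h) < W :=
    (ENNReal.ofReal_lt_iff_lt_toReal (Real.sqrt_nonneg _) (WpMart_ne_top hp0 hμ hν)).1
      (not_le.1 hWle)
  have hW : 0 < W := (Real.sqrt_nonneg _).trans_lt hsqrt
  have hWsq : a * h < W ^ 2 := (Real.sqrt_lt' hW).1 hsqrt
  obtain ⟨π, hπ, hπW⟩ := exists_isMartCoupling_integral_le hp0 hμ hν hW
  have hexp := hπ.integral_le hp.le hμ hν.1 hC hf2 hb hW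
  have hle_rem : ∫ x, f x ∂ν ≤ ∫ x, f x ∂μ + h * (c * (W ^ 2 / h) ^ (p / 2)) := by
    refine hexp.trans (add_le_add_right (le_trans ?_ (hrem h W h0 hle hW hWsq)) _)
    gcongr
  have hpen : ENNReal.ofReal (h * (c * (W ^ 2 / h) ^ (p / 2))) ≤ phih φ h (W ^ 2) := by
    rw [phih, ENNReal.ofReal_mul h0.le]
    gcongr
    exact hv₀ _ (hav.trans ((lt_div_iff₀ h0).2 hWsq).le)
  refine (EReal.sub_le_sub le_rfl (EReal.coe_ennreal_le_coe_ennreal_iff.2 hpen)).trans ?_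
  rw [EReal.coe_ennreal_ofReal, max_eq_left (by positivity), ← EReal.coe_sub, EReal.coe_le_coe_iff]
  linarith
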